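/- Let G be a finite simple graph and let v be a vertex of degree exactly 6 lying on exactly two pendent triangles v a1 a2 and v b1 b2 (a1, a2, b1, b2 distinct degree-2 vertices with a1~a2, b1~b2, and all four adjacent to v), with remaining neighbors u1 and u2, where each of u1, u2 has degree exactly 2 in G and does not lie on a pendent triangle (i.e., each u_i is a 2-vertex whose two neighbors are non-adjacent). If the graph G − {v, a1, a2, b1, b2, u1, u2} has an FII-partition, then G has an FII-partition. -/

import Mathlib

open scoped Classical

/-- `S` is a *2-independent set* of `G`: any two distinct vertices of `S` are at
distance at least 3 in `G`, i.e. they are non-adjacent and have no common neighbor. -/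
def TwoIndepSet {W : Type*} (G : SimpleGraph W) (S : Set W) : Prop :=
  ∀ u ∈ S, ∀ v ∈ S, u ≠ v → ¬G.Adj u v ∧ ∀ w, ¬(G.Adj u w ∧ G.Adj w v)

/-- `F ⊔ A ⊔ B` is an *FII-partition* of `G`: the three sets partition the vertex set,
the subgraph induced on `F` is a forest (acyclic), and `A`, `B` are 2-independent sets. -/
def IsFIIPartition {W : Type*} (G : SimpleGraph W) (F A B : Set W) : Prop :=
  (∀ v, v ∈ F ∨ v ∈ A ∨ v ∈ B) ∧
    Disjoint F A ∧ Disjoint F B ∧ Disjoint A B ∧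
    (G.induce F).IsAcyclic ∧ TwoIndepSet G A ∧ TwoIndepSet G B

/-- `G` admits some FII-partition. -/
def HasFIIPartition {W : Type*} (G : SimpleGraph W) : Prop :=
  ∃ F A B, IsFIIPartition G F A B

namespace SimpleGraph

variable {V : Type*} {G : SimpleGraph V}

lemma eq_or_eq_of_degree_eq_two {x p q : V} [Fintype (G.neighborSet x)] (hd : G.degree x = 2)
    (hp : G.Adj x p) (hq : G.Adj x q) (hpq : p ≠ q) {y : V} (hy : G.Adj x y) :
    y = p ∨ y = q := by
  have hsub : {p, q} ⊆ G.neighborFinset x := by simp [Finset.insert_subset_iff, hp, hq]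
  have heq := Finset.eq_of_subset_of_card_le hsub (by
    rw [card_neighborFinset_eq_degree, hd, Finset.card_pair hpq])
  have hmem : y ∈ G.neighborFinset x := by simpa using hy
  simpa [← heq] using hmem

lemma exists_forall_adj_of_degree_eq_two {x p : V} [Fintype (G.neighborSet x)]
    (hd : G.degree x = 2) (hp : G.Adj x p) :
    ∃ q, q ≠ p ∧ G.Adj x q ∧ ∀ y, G.Adj x y → y = p ∨ y = q := by
  obtain ⟨q, hq, hqp⟩ := Finset.exists_mem_ne (s := G.neighborFinset x)
    (by rw [card_neighborFinset_eq_degree]; lia) p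
  rw [mem_neighborFinset] at hq
  exact ⟨q, hqp, hq, fun y => eq_or_eq_of_degree_eq_two hd hp hq hqp.symm⟩

/-- Adding a vertex with at most one neighbor in a set inducing a forest yields a forest. -/
lemma IsAcyclic.induce_insert {S : Set V} {x : V} (hS : (G.induce S).IsAcyclic)
    (hx : ∀ y ∈ S, ∀ z ∈ S, G.Adj x y → G.Adj x z → y = z) :
    (G.induce (insert x S)).IsAcyclic := by
  intro u c hc
  by_cases hmem : (⟨x, Set.mem_insert x S⟩ : ↥(insert x S)) ∈ c.support
  · have hr := hc.rotate hmem
    have h1 := (c.rotate _ hmem).adj_snd hr.not_nil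
    have h2 := ((c.rotate _ hmem).adj_penultimate hr.not_nil).symm
    have mem_of_adj {y : ↥(insert x S)} (h : G.Adj x y) : (y : V) ∈ S :=
      y.2.resolve_left h.ne'
    exact hr.snd_ne_penultimate
      (Subtype.ext (hx _ (mem_of_adj h1) _ (mem_of_adj h2) h1 h2))
  · have hc' := hc.map (f := (Embedding.induce (G := G) (insert x S)).toHom)
      Subtype.val_injective
    have hsupp : ∀ y ∈ (c.map (Embedding.induce (G := G) (insert x S)).toHom).support,
        y ∈ S := by
      intro y hy
      rw [Walk.support_map, List.mem_map] at hy
      obtain ⟨z, hz, rfl⟩ := hy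
      refine z.2.resolve_left fun h => hmem ?_
      rwa [← show z = ⟨x, Set.mem_insert x S⟩ from Subtype.ext h]
    refine hS (Walk.induce S _ hsupp) ?_
    rw [← Walk.isCycle_map_iff_of_injective (f := (Embedding.induce (G := G) S).toHom)
      Subtype.val_injective]
    rwa [Walk.map_induce]

lemma IsAcyclic.induce_image_val {S : Set V} {F : Set S}
    (hF : ((G.induce S).induce F).IsAcyclic) :
    (G.induce (Subtype.val '' F)).IsAcyclic := by
  have hmem (x : ↥(Subtype.val '' F)) : ∃ h : (x : V) ∈ S, (⟨x, h⟩ : S) ∈ F := by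
    obtain ⟨_, y, hy, rfl⟩ := x
    exact ⟨y.2, hy⟩
  refine hF.comap ⟨fun x => ⟨⟨x, (hmem x).1⟩, (hmem x).2⟩, fun h => h⟩ fun x y hxy => ?_
  exact Subtype.ext (congrArg (fun z : F => (z : V)) hxy)

end SimpleGraph

section TwoIndepSet

variable {V : Type*} {G : SimpleGraph V}

lemma TwoIndepSet.image_val {S : Set V} {A : Set S} (hA : TwoIndepSet (G.induce S) A)
    (hS : ∀ x ∉ S, ∀ y ∈ S, ∀ z ∈ S, G.Adj x y → G.Adj x z → y = z) :
    TwoIndepSet G (Subtype.val '' A) := by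
  rintro _ ⟨y, hy, rfl⟩ _ ⟨z, hz, rfl⟩ hne
  obtain ⟨hadj, hcommon⟩ := hA y hy z hz (fun h => hne (congrArg _ h))
  refine ⟨hadj, fun w hw => ?_⟩
  by_cases hwS : w ∈ S
  · exact hcommon ⟨w, hwS⟩ hw
  · exact hne (hS w hwS y y.2 z z.2 hw.1.symm hw.2)

lemma TwoIndepSet.insert {A : Set V} {x : V} (hA : TwoIndepSet G A)
    (hx : ∀ y ∈ A, ¬G.Adj x y ∧ ∀ w, ¬(G.Adj x w ∧ G.Adj w y)) :
    TwoIndepSet G (insert x A) := by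
  rintro y (rfl | hy) z (rfl | hz) hne
  · exact absurd rfl hne
  · exact hx z hz
  · exact ⟨fun h => (hx y hy).1 h.symm, fun w h => (hx y hy).2 w ⟨h.2.symm, h.1.symm⟩⟩
  · exact hA y hy z hz hne

end TwoIndepSet

set_option maxHeartbeats 400000 in
/-- [C'5] If `v` is a 6-vertex on two pendent triangles `v a1 a2`, `v b1 b2` whose
remaining two neighbors `u1, u2` are 2-vertices not on pendent triangles (their two
neighbors are non-adjacent), and `G − {v, a1, a2, b1, b2, u1, u2}` has an FII-partition,
then so does `G`. -/
theorem hasFIIPartition_of_six_vertex_two_triangles {V : Type*} [Fintype V]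
    (G : SimpleGraph V) (v a1 a2 b1 b2 u1 u2 : V)
    (hne : List.Pairwise (· ≠ ·) [v, a1, a2, b1, b2, u1, u2])
    (ha1 : G.Adj v a1) (ha2 : G.Adj v a2) (ha : G.Adj a1 a2)
    (hb1 : G.Adj v b1) (hb2 : G.Adj v b2) (hb : G.Adj b1 b2)
    (hu1 : G.Adj v u1) (hu2 : G.Adj v u2)
    (hdv : G.degree v = 6)
    (hda1 : G.degree a1 = 2) (hda2 : G.degree a2 = 2)
    (hdb1 : G.degree b1 = 2) (hdb2 : G.degree b2 = 2)
    (hdu1 : G.degree u1 = 2) (hdu2 : G.degree u2 = 2)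
    (hu1nt : ∀ a b, G.Adj u1 a → G.Adj u1 b → ¬G.Adj a b)
    (hu2nt : ∀ a b, G.Adj u2 a → G.Adj u2 b → ¬G.Adj a b)
    (h : HasFIIPartition (G.induce ({v, a1, a2, b1, b2, u1, u2} : Set V)ᶜ)) :
    HasFIIPartition G := by
  have hv (y) (hy : G.Adj v y) : y = a1 ∨ y = a2 ∨ y = b1 ∨ y = b2 ∨ y = u1 ∨ y = u2 := by
    have hcard : ({a1, a2, b1, b2, u1, u2} : Finset V).card = 6 := by
      simp only [List.pairwise_cons, List.mem_cons, List.not_mem_nil] at hne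
      grind
    have hsub : {a1, a2, b1, b2, u1, u2} ⊆ G.neighborFinset v := by
      simp [Finset.insert_subset_iff, *]
    have heq := Finset.eq_of_subset_of_card_le hsub (by
      rw [SimpleGraph.card_neighborFinset_eq_degree, hdv, hcard])
    have hmem : y ∈ G.neighborFinset v := by simpa using hy
    simpa [← heq] using hmem
  have hNa1 (y) : G.Adj a1 y → y = v ∨ y = a2 :=
    SimpleGraph.eq_or_eq_of_degree_eq_two hda1 ha1.symm ha ha2.ne
  have hNa2 (y) : G.Adj a2 y → y = v ∨ y = a1 :=
    SimpleGraph.eq_or_eq_of_degree_eq_two hda2 ha2.symm ha.symm ha1.ne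
  have hNb1 (y) : G.Adj b1 y → y = v ∨ y = b2 :=
    SimpleGraph.eq_or_eq_of_degree_eq_two hdb1 hb1.symm hb hb2.ne
  have hNb2 (y) : G.Adj b2 y → y = v ∨ y = b1 :=
    SimpleGraph.eq_or_eq_of_degree_eq_two hdb2 hb2.symm hb.symm hb1.ne
  obtain ⟨w1, hw1v, huw1, hNu1⟩ :=
    SimpleGraph.exists_forall_adj_of_degree_eq_two hdu1 hu1.symm
  obtain ⟨w2, hw2v, huw2, hNu2⟩ :=
    SimpleGraph.exists_forall_adj_of_degree_eq_two hdu2 hu2.symm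
  have hvw1 : ¬G.Adj v w1 := hu1nt v w1 hu1.symm huw1
  have hvw2 : ¬G.Adj v w2 := hu2nt v w2 hu2.symm huw2
  simp only [List.pairwise_cons, List.mem_cons, List.not_mem_nil] at hne
  set X : Set V := {v, a1, a2, b1, b2, u1, u2} with hX
  have hXmem (x) : x ∈ X ↔
      x = v ∨ x = a1 ∨ x = a2 ∨ x = b1 ∨ x = b2 ∨ x = u1 ∨ x = u2 := by simp [hX]
  clear_value X
  have hout : ∀ x ∉ Xᶜ, ∀ y ∈ Xᶜ, ∀ z ∈ Xᶜ, G.Adj x y → G.Adj x z → y = z := by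
    simp only [Set.mem_compl_iff, hXmem]
    grind
  obtain ⟨F', A', B', hcover', hFA', hFB', hAB', hF', hA', hB'⟩ := h
  obtain ⟨F, hFdef⟩ : ∃ F : Set V, F = Subtype.val '' F' := ⟨_, rfl⟩
  obtain ⟨A, hAdef⟩ : ∃ A : Set V, A = Subtype.val '' A' := ⟨_, rfl⟩
  obtain ⟨B, hBdef⟩ : ∃ B : Set V, B = Subtype.val '' B' := ⟨_, rfl⟩
  have hF : (G.induce F).IsAcyclic := hFdef ▸ hF'.induce_image_val
  have hA : TwoIndepSet G A := hAdef ▸ hA'.image_val hout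
  have hB : TwoIndepSet G B := hBdef ▸ hB'.image_val hout
  have hFA : Disjoint F A := by
    rw [hFdef, hAdef]; exact (Set.disjoint_image_iff Subtype.val_injective).2 hFA'
  have hFB : Disjoint F B := by
    rw [hFdef, hBdef]; exact (Set.disjoint_image_iff Subtype.val_injective).2 hFB'
  have hAB : Disjoint A B := by
    rw [hAdef, hBdef]; exact (Set.disjoint_image_iff Subtype.val_injective).2 hAB'
  have hFX : ∀ x ∈ F, x ∉ X := by rw [hFdef]; rintro _ ⟨x, -, rfl⟩; exact x.2
  have hAX : ∀ x ∈ A, x ∉ X := by rw [hAdef]; rintro _ ⟨x, -, rfl⟩; exact x.2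
  have hBX : ∀ x ∈ B, x ∉ X := by rw [hBdef]; rintro _ ⟨x, -, rfl⟩; exact x.2
  have hcover : ∀ x, x ∉ X → x ∈ F ∨ x ∈ A ∨ x ∈ B := by
    intro x hx
    rw [hFdef, hAdef, hBdef]
    exact (hcover' ⟨x, hx⟩).imp (fun h => ⟨_, h, rfl⟩)
      (Or.imp (fun h => ⟨_, h, rfl⟩) (fun h => ⟨_, h, rfl⟩))
  clear hFdef hAdef hBdef hF' hA' hB' hFA' hFB' hAB' hcover' hout
  simp only [hXmem] at hFX hAX hBX hcover
  rw [Set.disjoint_left] at hFA hFB hAB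
  have hFforest : (G.induce (insert b2 (insert b1 (insert a2 (insert a1
      (insert u2 (insert u1 F))))))).IsAcyclic := by
    refine (((((hF.induce_insert ?_).induce_insert ?_).induce_insert ?_).induce_insert
      ?_).induce_insert ?_).induce_insert ?_ <;>
    grind
  have hstar (hw1 : w1 ∉ F) (hw2 : w2 ∉ F) : (G.induce (insert b2 (insert a2
      (insert u2 (insert u1 (insert v F)))))).IsAcyclic := by
    refine ((((hF.induce_insert ?_).induce_insert ?_).induce_insert ?_).induce_insert
      ?_).induce_insert ?_ <;>
    grind
  have insert_v {S : Set V} (hS : TwoIndepSet G S) (hSX : ∀ x ∈ S, ¬(x = v ∨ x = a1 ∨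
      x = a2 ∨ x = b1 ∨ x = b2 ∨ x = u1 ∨ x = u2)) (hw1 : w1 ∉ S) (hw2 : w2 ∉ S) :
      TwoIndepSet G (insert v S) :=
    hS.insert (by grind)
  by_cases hwA : w1 ∉ A ∧ w2 ∉ A
  · refine ⟨_, insert v A, B, ?_, ?_, ?_, ?_, hFforest,
      insert_v hA hAX hwA.1 hwA.2, hB⟩ <;>
    simp only [Set.disjoint_left, Set.mem_insert_iff] <;> grind
  by_cases hwB : w1 ∉ B ∧ w2 ∉ B
  · refine ⟨_, A, insert v B, ?_, ?_, ?_, ?_, hFforest, hA,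
      insert_v hB hBX hwB.1 hwB.2⟩ <;>
    simp only [Set.disjoint_left, Set.mem_insert_iff] <;> grind
  · refine ⟨_, insert a1 A, insert b1 B, ?_, ?_, ?_, ?_, hstar (by grind) (by grind),
      hA.insert (by grind), hB.insert (by grind)⟩ <;>
    simp only [Set.disjoint_left, Set.mem_insert_iff] <;> grind
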